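/- Let n ≥ 3 and δ ∈ (0,(n−1)/(n+1)). Let μ ∈ Δ^n_+ satisfy max_i μ_i ≤ 1−δ and suppose exactly k ≥ 1 of the components of μ are equal to 1−δ (and all other components are strictly smaller than 1−δ). Then the image ν = Ř(μ) under the split-merge prerule has exactly k−1 components equal to 1−δ, and all other components of ν are strictly smaller than 1−δ. -/

import Mathlib

open scoped BigOperators

/-- The open unit simplex `Δ⁺ₙ`. -/
def simplexPos (n : ℕ) : Set (Fin n → ℝ) := {μ | (∀ i, 0 < μ i) ∧ ∑ i, μ i = 1}

/-- The permutation `p` ranking the components of `μ` in decreasing order,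
ties broken in increasing order of index (stable sort of `-μ`). -/
noncomputable def rankPerm {n : ℕ} (μ : Fin n → ℝ) : Equiv.Perm (Fin n) :=
  Tuple.sort (fun i => -μ i)

/-- The `k`-th reverse order statistic `μ₍ₖ₊₁₎` (0-indexed): `ordStat μ 0` is the
largest component, `ordStat μ (n-1)` the smallest. -/
noncomputable def ordStat {n : ℕ} (μ : Fin n → ℝ) (k : Fin n) : ℝ :=
  μ (rankPerm μ k)

/-- The split-merge prerule `Ř` with diversity parameter `δ`: if `μ₍₁₎ ≥ 1-δ`, the largest
company (rank 1) is split in half, the new half being placed at the index of rank `n-1`,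
whose previous two smallest values (ranks `n-1`, `n`) merge into the index of rank `n`;
otherwise (and when `n < 3`) it is the identity. -/
noncomputable def preRule {n : ℕ} (δ : ℝ) (μ : Fin n → ℝ) : Fin n → ℝ :=
  if hn : 3 ≤ n then
    if ordStat μ ⟨0, by omega⟩ < 1 - δ then μ
    else fun i =>
      if ((rankPerm μ).symm i : ℕ) = 0 then ordStat μ ⟨0, by omega⟩ / 2
      else if ((rankPerm μ).symm i : ℕ) = n - 2 then ordStat μ ⟨0, by omega⟩ / 2
      else if ((rankPerm μ).symm i : ℕ) = n - 1 then
        ordStat μ ⟨n - 1, by omega⟩ + ordStat μ ⟨n - 2, by omega⟩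
      else μ i
  else μ

/-- The entropy function `S(x) = -∑ xᵢ log xᵢ`. -/
noncomputable def entS {n : ℕ} (x : Fin n → ℝ) : ℝ := -∑ i, x i * Real.log (x i)

/-- The order statistics are decreasing in the rank. -/
theorem ordStat_antitone {n : ℕ} (μ : Fin n → ℝ) : Antitone (ordStat μ) := by
  intro i j hij
  have h := Tuple.monotone_sort (fun i => -μ i) hij
  simp only [Function.comp_apply] at h
  exact neg_le_neg_iff.mp h

theorem sum_ordStat {n : ℕ} (μ : Fin n → ℝ) : ∑ j, ordStat μ j = ∑ i, μ i :=
  Equiv.sum_comp (rankPerm μ) μ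

/-- The largest component plus `(n - 1) / 2` times the sum of the two smallest components is at
most the total. -/
theorem ordStat_add_mul_le_sum {n : ℕ} (hn : 3 ≤ n) (μ : Fin n → ℝ) :
    ordStat μ ⟨0, by omega⟩ +
      ((n : ℝ) - 1) * ((ordStat μ ⟨n - 1, by omega⟩ + ordStat μ ⟨n - 2, by omega⟩) / 2) ≤
      ∑ i, μ i := by
  set z : Fin n := ⟨0, by omega⟩ with hz
  set y : Fin n := ⟨n - 2, by omega⟩ with hy
  set w : Fin n := ⟨n - 1, by omega⟩ with hw
  set a := (ordStat μ w + ordStat μ y) / 2 with ha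
  have hwy : ordStat μ w ≤ ordStat μ y :=
    ordStat_antitone μ (by simp only [hy, hw, Fin.mk_le_mk]; omega)
  have hzy : z ≠ y := by simp only [hz, hy, ne_eq, Fin.mk.injEq]; omega
  have hzw : z ≠ w := by simp only [hz, hw, ne_eq, Fin.mk.injEq]; omega
  have hne : y ≠ w := by simp only [hy, hw, ne_eq, Fin.mk.injEq]; omega
  have hle : ∀ j, a + (if j = z then ordStat μ z - a else 0) +
      (if j = y then ordStat μ y - a else 0) +
      (if j = w then ordStat μ w - a else 0) ≤ ordStat μ j := by
    intro j
    by_cases h1 : j = z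
    · subst h1; simp [hzy, hzw]
    by_cases h2 : j = y
    · subst h2; simp [h1, hne]
    by_cases h3 : j = w
    · subst h3; simp [h1, h2]
    have hj : ordStat μ y ≤ ordStat μ j := ordStat_antitone μ (by
      rw [Fin.ext_iff] at h3
      rw [Fin.le_def]
      simp only [hy, hw] at h3 ⊢
      omega)
    simp only [h1, h2, h3, if_false]
    linarith
  have hsum := Finset.sum_le_sum (fun j (_ : j ∈ Finset.univ) => hle j)
  rw [sum_ordStat] at hsum
  simp only [Finset.sum_add_distrib, Finset.sum_ite_eq', Finset.mem_univ, if_true,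
    Finset.sum_const, Finset.card_univ, Fintype.card_fin, nsmul_eq_mul] at hsum
  linarith

/-- If `μ ∈ Δ⁺ₙ` has all weights `≤ 1-δ` and exactly `k ≥ 1` weights equal
to `1-δ`, then `Ř(μ)` has exactly `k-1` weights equal to `1-δ`, all of its other weights
being strictly smaller than `1-δ`. -/
theorem preRule_reduces_boundary_count
    (n : ℕ) (hn : 3 ≤ n) (δ : ℝ)
    (hδ : δ ∈ Set.Ioo (0 : ℝ) (((n : ℝ) - 1) / ((n : ℝ) + 1)))
    (μ : Fin n → ℝ) (hμ : μ ∈ simplexPos n) (k : ℕ) (hk : 1 ≤ k)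
    (hmax : ∀ i, μ i ≤ 1 - δ)
    (hcard : (Finset.univ.filter (fun i => μ i = 1 - δ)).card = k) :
    (Finset.univ.filter (fun i => preRule δ μ i = 1 - δ)).card = k - 1 ∧
      ∀ i, preRule δ μ i ≠ 1 - δ → preRule δ μ i < 1 - δ := by
  obtain ⟨hpos, hsum⟩ := hμ
  have hn3 : (3 : ℝ) ≤ n := by exact_mod_cast hn
  have hbound : 2 < (1 - δ) * ((n : ℝ) + 1) := by
    have h := (lt_div_iff₀ (by linarith)).mp hδ.2
    linarith
  have hM : 0 < 1 - δ := by
    by_contra! h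
    nlinarith
  obtain ⟨m, hm⟩ : ∃ m, μ m = 1 - δ := by
    have h : 0 < (Finset.univ.filter (fun i => μ i = 1 - δ)).card := by omega
    obtain ⟨m, hm⟩ := Finset.card_pos.mp h
    exact ⟨m, (Finset.mem_filter.mp hm).2⟩
  have htop : ordStat μ ⟨0, by omega⟩ = 1 - δ := by
    refine le_antisymm (hmax _) ?_
    have h := ordStat_antitone μ
      (show (⟨0, by omega⟩ : Fin n) ≤ (rankPerm μ).symm m from Nat.zero_le _)
    rwa [ordStat, Equiv.apply_symm_apply, hm] at h
  have hmerge : ordStat μ ⟨n - 1, by omega⟩ + ordStat μ ⟨n - 2, by omega⟩ < 1 - δ := by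
    have h := ordStat_add_mul_le_sum hn μ
    rw [htop, hsum] at h
    by_contra! hge
    nlinarith
  have hlast : 0 < ordStat μ ⟨n - 1, by omega⟩ := hpos _
  have hlast' : 0 < ordStat μ ⟨n - 2, by omega⟩ := hpos _
  have hrule : ∀ i, (i = rankPerm μ ⟨0, by omega⟩ ∧ preRule δ μ i < 1 - δ) ∨
      (i ≠ rankPerm μ ⟨0, by omega⟩ ∧
        (preRule δ μ i = μ i ∨ (preRule δ μ i < 1 - δ ∧ μ i < 1 - δ))) := by
    intro i
    obtain ⟨j, rfl⟩ := (rankPerm μ).surjective i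
    simp only [preRule, dif_pos hn, htop, lt_irrefl, if_false, Equiv.symm_apply_apply,
      EmbeddingLike.apply_eq_iff_eq, Fin.ext_iff, ne_eq]
    by_cases h0 : (j : ℕ) = 0
    · left
      simp only [h0, if_true, true_and]
      linarith
    right
    refine ⟨h0, ?_⟩
    rw [if_neg h0]
    by_cases h2 : (j : ℕ) = n - 2
    · have hj : j = ⟨n - 2, by omega⟩ := Fin.ext h2
      rw [if_pos h2, hj]
      rw [ordStat, ordStat] at hmerge
      rw [ordStat] at hlast
      exact Or.inr ⟨by linarith, by linarith⟩
    rw [if_neg h2]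
    by_cases h1 : (j : ℕ) = n - 1
    · have hj : j = ⟨n - 1, by omega⟩ := Fin.ext h1
      rw [if_pos h1, hj]
      refine Or.inr ⟨hmerge, ?_⟩
      rw [ordStat, ordStat] at hmerge
      rw [ordStat] at hlast'
      linarith
    rw [if_neg h1]
    exact Or.inl rfl
  constructor
  · have herase : Finset.univ.filter (fun i => preRule δ μ i = 1 - δ) =
        (Finset.univ.filter (fun i => μ i = 1 - δ)).erase (rankPerm μ ⟨0, by omega⟩) := by
      ext i
      simp only [Finset.mem_filter, Finset.mem_univ, true_and, Finset.mem_erase]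
      rcases hrule i with ⟨hi, h⟩ | ⟨hi, h | ⟨h, h'⟩⟩
      · simp [hi ▸ h.ne, hi]
      · simp [hi, h]
      · simp [h.ne, h'.ne]
    rw [herase, Finset.card_erase_of_mem, hcard]
    exact Finset.mem_filter.mpr ⟨Finset.mem_univ _, htop⟩
  · intro i hi
    rcases hrule i with ⟨-, h⟩ | ⟨-, h | ⟨h, -⟩⟩
    · exact h
    · exact lt_of_le_of_ne (h ▸ hmax i) hi
    · exact h
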